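/- Let t and n be positive integers and let F_1, ..., F_n be a family of finite sets. The family has a set of distinct t-representatives (i.e., there exist pairwise disjoint sets R_1, ..., R_n with R_i ⊆ F_i and |R_i| = t for every i) if and only if for every subset I ⊆ {1,...,n} the union ⋃_{i∈I} F_i contains at least t·|I| elements. -/

import Mathlib

/-- **Generalized Hall theorem (finite version).** A family `F₁, …, Fₙ` of finite sets
has a set of distinct `t`-representatives (pairwise disjoint `t`-element subsets
`Rᵢ ⊆ Fᵢ`) iff every subfamily indexed by `I` has union of size at least `t·|I|`. -/
theorem stmt0 {α : Type*} [DecidableEq α] (t n : ℕ) (ht : 0 < t) (hn : 0 < n)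
    (F : Fin n → Finset α) :
    (∃ R : Fin n → Finset α,
        (∀ i, R i ⊆ F i ∧ (R i).card = t) ∧
        ∀ i j, i ≠ j → Disjoint (R i) (R j)) ↔
      ∀ I : Finset (Fin n), t * I.card ≤ (I.biUnion F).card := by
  constructor
  · rintro ⟨R, hR, hdisj⟩ I
    calc t * I.card = ∑ i ∈ I, (R i).card := by
          rw [Finset.sum_congr rfl fun i _ => (hR i).2, Finset.sum_const, smul_eq_mul, mul_comm]
      _ = (I.biUnion R).card :=
          (Finset.card_biUnion fun i _ j _ hij => hdisj i j hij).symm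
      _ ≤ (I.biUnion F).card :=
          Finset.card_le_card (Finset.biUnion_mono fun i _ => (hR i).1)
  · intro h
    -- Apply Hall's theorem to the family in which each `F i` is repeated `t` times.
    have hall : ∀ s : Finset (Fin n × Fin t), s.card ≤ (s.biUnion fun p => F p.1).card := by
      intro s
      have hs : s ⊆ s.image Prod.fst ×ˢ Finset.univ := fun p hp =>
        Finset.mem_product.2 ⟨Finset.mem_image_of_mem _ hp, Finset.mem_univ _⟩
      calc s.card ≤ (s.image Prod.fst ×ˢ (Finset.univ : Finset (Fin t))).card :=
            Finset.card_le_card hs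
        _ = t * (s.image Prod.fst).card := by
            rw [Finset.card_product, Finset.card_univ, Fintype.card_fin, mul_comm]
        _ ≤ ((s.image Prod.fst).biUnion F).card := h _
        _ = (s.biUnion fun p => F p.1).card := by rw [Finset.image_biUnion]
    obtain ⟨f, hf, hmem⟩ :=
      (Finset.all_card_le_biUnion_card_iff_exists_injective _).1 hall
    refine ⟨fun i => Finset.univ.image fun j => f (i, j), fun i => ⟨?_, ?_⟩, ?_⟩
    · exact Finset.image_subset_iff.2 fun j _ => hmem (i, j)
    · rw [Finset.card_image_of_injective _ fun j k hjk => (Prod.mk.inj (hf hjk)).2,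
        Finset.card_univ, Fintype.card_fin]
    · intro i j hij
      refine Finset.disjoint_left.2 fun x hxi hxj => hij ?_
      obtain ⟨k, -, rfl⟩ := Finset.mem_image.1 hxi
      obtain ⟨l, -, hl⟩ := Finset.mem_image.1 hxj
      exact (Prod.mk.inj (hf hl)).1.symm
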